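/- arXiv:1804.08034 — 5 statements merged into one kernel-verified Lean document; each statement's English description precedes it below -/
import Mathlib

section
/- Let N be a finite nonempty set of flows with positive weights φ_j > 0, served by a GPS scheduler whose service process C complies to a function 𝒞 (i.e., C(t) − C(s) ≥ 𝒞(t−s) for all 0 ≤ s ≤ t), where 𝒞 is convex and nondecreasing on [0,∞) with 𝒞(τ) = 0 for τ ≤ 0. Fix a flow i ∈ N, and assume that for each j ∈ N \ {i} the arrival process A_j complies to an envelope E_j (i.e., A_j(t) − A_j(s) ≤ E_j(t−s) for all 0 ≤ s ≤ t) which is concave, nonnegative and nondecreasing on (0,∞) with E_j(τ) = 0 for τ ≤ 0. Define the leftover service curve S_i(τ) := max over subsets M ⊆ N \ {i} of (φ_i / Σ_{j∈N\M} φ_j)·(𝒞(τ) − Σ_{j∈M} E_j(τ)). Then S_i is a strict service curve for flow i: for all 0 ≤ s < t such that the backlog B_i(u) = A_i(u) − D_i(u) > 0 for every u ∈ (s,t), the departures satisfy D_i(t) − D_i(s) ≥ S_i(t−s). -/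
/-- Last time before `b` at which a nonnegative left-continuous function vanishes. -/
theorem gps_last_empty (f : ℝ → ℝ) (hf : ∀ t, ContinuousWithinAt f (Set.Iio t) t)
    (h0 : ∀ t, 0 ≤ f t) (a b : ℝ) (hab : a ≤ b) (ha : f a = 0) :
    ∃ w, a ≤ w ∧ w ≤ b ∧ f w = 0 ∧ ∀ v, w < v → v ≤ b → 0 < f v := by
  set S : Set ℝ := {v | a ≤ v ∧ v ≤ b ∧ f v = 0} with hS
  have hne : S.Nonempty := ⟨a, le_refl a, hab, ha⟩
  have hbdd : BddAbove S := ⟨b, fun v hv => hv.2.1⟩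
  have haw : a ≤ sSup S := le_csSup hbdd ⟨le_refl a, hab, ha⟩
  have hwb : sSup S ≤ b := csSup_le hne (fun v hv => hv.2.1)
  refine ⟨sSup S, haw, hwb, ?_, ?_⟩
  · by_contra hw
    have hpos : 0 < f (sSup S) := lt_of_le_of_ne (h0 _) (Ne.symm hw)
    have hev : ∀ᶠ v in nhdsWithin (sSup S) (Set.Iio (sSup S)), 0 < f v :=
      (hf (sSup S)).eventually (lt_mem_nhds hpos)
    obtain ⟨l, hl, hl2⟩ := (mem_nhdsLT_iff_exists_Ioo_subset).1 hev
    obtain ⟨v, hv, hlv⟩ := exists_lt_of_lt_csSup hne hl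
    have hvw : v ≤ sSup S := le_csSup hbdd hv
    have hne' : v ≠ sSup S := by
      intro h
      exact hw (h ▸ hv.2.2)
    have : 0 < f v := hl2 ⟨hlv, lt_of_le_of_ne hvw hne'⟩
    exact absurd hv.2.2 this.ne'
  · intro v hv hvb
    refine lt_of_le_of_ne (h0 v) (fun h => ?_)
    exact absurd (le_csSup hbdd (show v ∈ S from ⟨haw.trans hv.le, hvb, h.symm⟩)) (not_le.2 hv)

theorem gps_concave_star (e : ℝ → ℝ) (hc : ConcaveOn ℝ (Set.Ioi (0:ℝ)) e)
    (h0 : ∀ τ, 0 < τ → 0 ≤ e τ) (y x : ℝ) (hy : 0 < y) (hyx : y ≤ x) :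
    y * e x ≤ x * e y := by
  rcases hyx.eq_or_lt with rfl | hlt
  · exact le_refl _
  have key : ∀ δ, 0 < δ → δ < y → (y - δ) * e x ≤ x * e y := by
    intro δ hδ hδy
    have hxd : 0 < x - δ := by linarith
    have := hc.2 (show δ ∈ Set.Ioi (0:ℝ) from hδ) (show x ∈ Set.Ioi (0:ℝ) from hy.trans hlt)
      (show 0 ≤ (x - y) / (x - δ) from div_nonneg (by linarith) hxd.le)
      (show 0 ≤ (y - δ) / (x - δ) from div_nonneg (by linarith) hxd.le)
      (by field_simp; ring)
    have hpt : ((x - y) / (x - δ)) • δ + ((y - δ) / (x - δ)) • x = y := by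
      simp only [smul_eq_mul]; field_simp; ring
    rw [hpt] at this
    simp only [smul_eq_mul] at this
    have h2 : (x - y) * e δ + (y - δ) * e x ≤ (x - δ) * e y := by
      have h3 := mul_le_mul_of_nonneg_left this hxd.le
      have h4 : (x - δ) * ((x - y) / (x - δ) * e δ + (y - δ) / (x - δ) * e x)
        = (x - y) * e δ + (y - δ) * e x := by field_simp
      linarith
    nlinarith [mul_nonneg (sub_nonneg.2 hyx) (h0 δ hδ), mul_nonneg hδ.le (h0 y hy)]
  have ht : Filter.Tendsto (fun δ : ℝ => (y - δ) * e x) (nhdsWithin 0 (Set.Ioi 0))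
      (nhds ((y - 0) * e x)) := by
    apply Filter.Tendsto.mono_left _ nhdsWithin_le_nhds
    exact Continuous.tendsto (by fun_prop) 0
  rw [sub_zero] at ht
  refine le_of_tendsto ht ?_
  filter_upwards [Ioo_mem_nhdsGT hy] with δ hδ using key δ hδ.1 hδ.2

theorem gps_convex_star (c : ℝ → ℝ) (hc : ConvexOn ℝ (Set.Ici (0:ℝ)) c) (h0 : c 0 = 0)
    (y x : ℝ) (hy : 0 < y) (hyx : y ≤ x) : x * c y ≤ y * c x := by
  have hx : 0 < x := hy.trans_le hyx
  have := hc.2 (show (0:ℝ) ∈ Set.Ici (0:ℝ) from le_refl (0:ℝ)) (show x ∈ Set.Ici (0:ℝ) from hx.le)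
      (show 0 ≤ (x - y) / x from div_nonneg (by linarith) hx.le)
      (show 0 ≤ y / x from div_nonneg hy.le hx.le)
      (by field_simp; ring)
  have hpt : ((x - y) / x) • (0:ℝ) + (y / x) • x = y := by
    simp only [smul_eq_mul]; field_simp; ring
  rw [hpt, h0] at this
  simp only [smul_eq_mul, mul_zero, zero_add] at this
  have h3 := mul_le_mul_of_nonneg_left this hx.le
  have h4 : x * (y / x * c x) = y * c x := by field_simp
  linarith

/-- **Theorem 1, leftover service curve.** Let the service process of
a GPS scheduler comply to a convex, nondecreasing strict service curve `𝒞`, and let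
the arrivals of every flow `j ≠ i` comply to a concave, nonnegative, nondecreasing
envelope `E_j`.  Then
`S_i(τ) := max_{M ⊆ N\{i}} (φ_i / ∑_{j∉M} φ_j) (𝒞(τ) - ∑_{j∈M} E_j(τ))`
is a strict service curve for flow `i`:  on any interval `(s,t)` throughout which
flow `i` is backlogged, `D_i(s,t) ≥ S_i(t - s)`. -/
theorem gps_leftover_service_curve {ι : Type*} [DecidableEq ι] (N : Finset ι) (hN : N.Nonempty)
    (φ : ι → ℝ) (A D : ι → ℝ → ℝ) (C : ℝ → ℝ)
    (hφ : ∀ j ∈ N, 0 < φ j)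
    (hAmono : ∀ j ∈ N, Monotone (A j))
    (hAlc : ∀ j ∈ N, ∀ t : ℝ, ContinuousWithinAt (A j) (Set.Iio t) t)
    (hAzero : ∀ j ∈ N, ∀ t : ℝ, t ≤ 0 → A j t = 0)
    (hDmono : ∀ j ∈ N, Monotone (D j))
    (hDlc : ∀ j ∈ N, ∀ t : ℝ, ContinuousWithinAt (D j) (Set.Iio t) t)
    (hDzero : ∀ j ∈ N, ∀ t : ℝ, t ≤ 0 → D j t = 0)
    (hCmono : Monotone C)
    (hClc : ∀ t : ℝ, ContinuousWithinAt C (Set.Iio t) t)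
    (hCzero : ∀ t : ℝ, t ≤ 0 → C t = 0)
    (hDA : ∀ j ∈ N, ∀ t : ℝ, D j t ≤ A j t)
    (hwork_le : ∀ s t : ℝ, 0 ≤ s → s ≤ t → ∑ j ∈ N, (D j t - D j s) ≤ C t - C s)
    (hwork_eq : ∀ s t : ℝ, 0 ≤ s → s ≤ t →
      (∀ u : ℝ, s < u → u < t → 0 < ∑ j ∈ N, (A j u - D j u)) →
      ∑ j ∈ N, (D j t - D j s) = C t - C s)
    (hfair : ∀ s t : ℝ, 0 ≤ s → s < t → ∀ i ∈ N,
      (∀ u : ℝ, s < u → u < t → 0 < A i u - D i u) →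
      ∀ j ∈ N, (D j t - D j s) / φ j ≤ (D i t - D i s) / φ i)
    (i : ι) (hi : i ∈ N)
    (𝒞 : ℝ → ℝ) (E : ι → ℝ → ℝ)
    (h𝒞conv : ConvexOn ℝ (Set.Ici (0:ℝ)) 𝒞)
    (h𝒞mono : MonotoneOn 𝒞 (Set.Ici (0:ℝ)))
    (h𝒞zero : ∀ τ : ℝ, τ ≤ 0 → 𝒞 τ = 0)
    (hCcomp : ∀ s t : ℝ, 0 ≤ s → s ≤ t → 𝒞 (t - s) ≤ C t - C s)
    (hEconc : ∀ j ∈ N.erase i, ConcaveOn ℝ (Set.Ioi (0:ℝ)) (E j))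
    (hEnonneg : ∀ j ∈ N.erase i, ∀ τ : ℝ, 0 < τ → 0 ≤ E j τ)
    (hEmono : ∀ j ∈ N.erase i, MonotoneOn (E j) (Set.Ioi (0:ℝ)))
    (hEzero : ∀ j ∈ N.erase i, ∀ τ : ℝ, τ ≤ 0 → E j τ = 0)
    (hAenv : ∀ j ∈ N.erase i, ∀ s t : ℝ, 0 ≤ s → s ≤ t → A j t - A j s ≤ E j (t - s)) :
    ∀ s t : ℝ, 0 ≤ s → s < t →
      (∀ u : ℝ, s < u → u < t → 0 < A i u - D i u) →
      (N.erase i).powerset.sup' ⟨∅, Finset.empty_mem_powerset _⟩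
          (fun M => (φ i / ∑ j ∈ N \ M, φ j) * (𝒞 (t - s) - ∑ j ∈ M, E j (t - s))) ≤
        D i t - D i s := by
  intro s t hs hst hback
  have hτ : 0 < t - s := sub_pos.2 hst
  have hφi := hφ i hi
  set p : ℝ := (D i t - D i s) / φ i with hp
  have hp0 : 0 ≤ p := div_nonneg (sub_nonneg.2 (hDmono i hi hst.le)) hφi.le
  have hDp : D i t - D i s = φ i * p := by rw [hp]; field_simp
  have hfairp : ∀ k ∈ N, D k t - D k s ≤ φ k * p := by
    intro k hk
    have := hfair s t hs hst i hi hback k hk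
    rw [div_le_iff₀ (hφ k hk)] at this
    linarith
  have hBnn : ∀ k ∈ N, ∀ v, 0 ≤ A k v - D k v := fun k hk v => sub_nonneg.2 (hDA k hk v)
  -- last time the aggregate backlog vanishes
  obtain ⟨w, hw0, hws, hwz, hwpos⟩ := gps_last_empty (fun v => ∑ j ∈ N, (A j v - D j v))
    (fun v => by
      refine tendsto_finsetSum N (fun k hk => ?_)
      exact (hAlc k hk v).sub (hDlc k hk v))
    (fun v => Finset.sum_nonneg (fun k hk => hBnn k hk v)) 0 s hs
    (Finset.sum_eq_zero (fun k hk => by rw [hAzero k hk 0 le_rfl, hDzero k hk 0 le_rfl, sub_zero]))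
  have hwk : ∀ k ∈ N, A k w - D k w = 0 :=
    (Finset.sum_eq_zero_iff_of_nonneg (fun k hk => hBnn k hk w)).1 hwz
  have hC : ∀ u, w ≤ u → u ≤ s → ∑ j ∈ N, (D j t - D j u) = C t - C u := by
    intro u hwu hus
    refine hwork_eq u t (hw0.trans hwu) (hus.trans hst.le) (fun v huv hvt => ?_)
    rcases le_or_gt v s with hvs | hvs
    · exact hwpos v (hwu.trans_lt huv) hvs
    · exact Finset.sum_pos' (fun k hk => hBnn k hk v) ⟨i, hi, hback v hvs hvt⟩
  have main : ∀ M ⊆ N.erase i, ∀ σ : ℝ, 0 ≤ σ →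
      σ * ∑ j ∈ N \ M, φ j ≤ 𝒞 (t - s) - ∑ j ∈ M, E j (t - s) →
      (∀ j ∈ M, E j (t - s) ≤ φ j * σ) → σ ≤ p := by
    intro M hM σ hσ hMσ hEσ
    have hMN : M ⊆ N := hM.trans (Finset.erase_subset _ _)
    set τ := t - s with hτdef
    set r := σ / τ with hr
    have hrτ : r * τ = σ := by rw [hr]; field_simp
    have hr0 : 0 ≤ r := div_nonneg hσ hτ.le
    set Q := ∑ j ∈ N \ M, φ j with hQ
    have hiM : i ∈ N \ M := by
      refine Finset.mem_sdiff.2 ⟨hi, fun h => ?_⟩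
      exact Finset.notMem_erase i N (hM h)
    have hQpos : 0 < Q := Finset.sum_pos (fun k hk => hφ k (Finset.mem_sdiff.1 hk).1) ⟨i, hiM⟩
    set R := ∑ j ∈ M, φ j with hR
    have hR0 : 0 ≤ R := Finset.sum_nonneg (fun k hk => (hφ k (hMN hk)).le)
    set G : ℝ → ℝ := fun v => ∑ j ∈ N \ M, D j v with hG
    have hGmono : Monotone G := fun a b hab =>
      Finset.sum_le_sum (fun k hk => hDmono k (Finset.mem_sdiff.1 hk).1 hab)
    -- envelope growth
    have hEy : ∀ j ∈ M, ∀ y, τ ≤ y → E j y ≤ y * (φ j * r) := by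
      intro j hj y hy
      have h1 := gps_concave_star (E j) (hEconc j (hM hj)) (hEnonneg j (hM hj)) τ y hτ hy
      have h2 : y * E j τ ≤ y * (φ j * σ) :=
        mul_le_mul_of_nonneg_left (hEσ j hj) (hτ.le.trans hy)
      rw [← hrτ] at h2
      have : τ * E j y ≤ τ * (y * (φ j * r)) := by linarith
      exact le_of_mul_le_mul_left this hτ
    have hEgrow : ∀ j ∈ M, ∀ y x, τ ≤ y → y ≤ x → E j x ≤ E j y + (x - y) * (φ j * r) := by
      intro j hj y x hy hyx
      have hy0 : 0 < y := hτ.trans_le hy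
      have h1 := gps_concave_star (E j) (hEconc j (hM hj)) (hEnonneg j (hM hj)) y x hy0 hyx
      have h2 := mul_le_mul_of_nonneg_left (hEy j hj y hy) (sub_nonneg.2 hyx)
      have : y * E j x ≤ y * (E j y + (x - y) * (φ j * r)) := by linarith
      exact le_of_mul_le_mul_left this hy0
    have hCE : ∀ y, τ ≤ y → y * r * Q ≤ 𝒞 y - ∑ j ∈ M, E j y := by
      intro y hy
      have hy0 : 0 < y := hτ.trans_le hy
      have h1 := gps_convex_star 𝒞 h𝒞conv (h𝒞zero 0 le_rfl) τ y hτ hy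
      have h2 : ∑ j ∈ M, τ * E j y ≤ ∑ j ∈ M, y * E j τ := Finset.sum_le_sum (fun j hj =>
        gps_concave_star (E j) (hEconc j (hM hj)) (hEnonneg j (hM hj)) τ y hτ hy)
      rw [← Finset.mul_sum, ← Finset.mul_sum] at h2
      have h3 := mul_le_mul_of_nonneg_left hMσ hy0.le
      rw [← hrτ] at h3
      have : τ * (y * r * Q) ≤ τ * (𝒞 y - ∑ j ∈ M, E j y) := by linarith
      exact le_of_mul_le_mul_left this hτ
    -- approximate minimizer of K
    set K : ℝ → ℝ := fun v => (G s - G v) / Q - r * (s - v) with hK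
    have hKs : K s = 0 := by simp [hK]
    have hGK : ∀ v, G s - G v = Q * (K v + r * (s - v)) := by
      intro v; simp only [hK]; field_simp; ring
    have hbdd : BddBelow (K '' Set.Icc w s) := by
      refine ⟨-(r * (s - w)), ?_⟩
      rintro _ ⟨v, hv, rfl⟩
      have h1 : 0 ≤ (G s - G v) / Q := div_nonneg (sub_nonneg.2 (hGmono hv.2)) hQpos.le
      have h2 : r * (s - v) ≤ r * (s - w) := mul_le_mul_of_nonneg_left (by linarith [hv.1]) hr0
      simp only [hK]; linarith
    have hne : (K '' Set.Icc w s).Nonempty := ⟨K s, s, ⟨hws, le_rfl⟩, rfl⟩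
    have step : ∀ ε, 0 < ε → σ * Q ≤ p * Q + (Q + R) * ε := by
      intro ε hε
      obtain ⟨_, ⟨u, hu, rfl⟩, huε⟩ := exists_lt_of_csInf_lt hne (lt_add_of_pos_right _ hε)
      have hmin : ∀ v, w ≤ v → v ≤ s → K u ≤ K v + ε := by
        intro v h1 h2
        have := csInf_le hbdd ⟨v, ⟨h1, h2⟩, rfl⟩
        linarith
      obtain ⟨hwu, hus⟩ := hu
      have hDk : ∀ k ∈ M, D k t - D k u ≤ E k (t - u) + φ k * ε := by
        intro k hk
        have hkN := hMN hk
        have hφk := hφ k hkN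
        obtain ⟨z, hwz', hzu, hz0, hzpos⟩ := gps_last_empty (fun v => A k v - D k v)
          (fun v => (hAlc k hkN v).sub (hDlc k hkN v)) (hBnn k hkN) w u hwu (hwk k hkN)
        have hz0' : A k z - D k z = 0 := hz0
        have hz : 0 ≤ z := hw0.trans hwz'
        have henv := hAenv k (hM hk) z t hz (by linarith)
        have hDAt := hDA k hkN t
        have hEg := hEgrow k hk (t - u) (t - z) (by linarith) (by linarith)
        have hfk : φ k * (G u - G z) ≤ Q * (D k u - D k z) := by
          rcases hzu.eq_or_lt with h | h
          · rw [h]; simp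
          · have hf := hfair z u hz h k hkN (fun v h1 h2 => hzpos v h1 h2.le)
            have h1 : G u - G z ≤ ∑ j ∈ N \ M, φ j * ((D k u - D k z) / φ k) := by
              simp only [hG]
              rw [← Finset.sum_sub_distrib]
              refine Finset.sum_le_sum (fun j hj => ?_)
              have hjN := (Finset.mem_sdiff.1 hj).1
              have := hf j hjN
              rw [div_le_iff₀ (hφ j hjN)] at this
              linarith
            rw [← Finset.sum_mul] at h1
            have h2 := mul_le_mul_of_nonneg_left h1 hφk.le
            have h3 : φ k * (Q * ((D k u - D k z) / φ k)) = Q * (D k u - D k z) := by field_simp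
            linarith
        have hm := hmin z hwz' (by linarith)
        have h4 : φ k * (r * (u - z) - ε) ≤ D k u - D k z := by
          have h5 : G u - G z = Q * (K z - K u + r * (u - z)) := by
            have := hGK u
            have := hGK z
            linarith
          rw [h5] at hfk
          have h6 : Q * (φ k * (K z - K u + r * (u - z))) ≤ Q * (D k u - D k z) := by linarith
          have h7 := le_of_mul_le_mul_left h6 hQpos
          have h8 : φ k * (r * (u - z) - ε) ≤ φ k * (K z - K u + r * (u - z)) :=
            mul_le_mul_of_nonneg_left (by linarith) hφk.le
          linarith
        linarith
      have hsumM : ∑ k ∈ M, (D k t - D k u) ≤ ∑ k ∈ M, E k (t - u) + R * ε := by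
        have := Finset.sum_le_sum hDk
        rw [Finset.sum_add_distrib, ← Finset.sum_mul] at this
        exact this
      have hsplit : ∑ j ∈ N \ M, (D j t - D j u) + ∑ j ∈ M, (D j t - D j u)
          = ∑ j ∈ N, (D j t - D j u) := Finset.sum_sdiff hMN
      rw [hC u hwu hus, Finset.sum_sub_distrib] at hsplit
      have hGt : G t - G s ≤ Q * p := by
        simp only [hG, hQ]
        rw [← Finset.sum_sub_distrib, Finset.sum_mul]
        exact Finset.sum_le_sum (fun j hj => hfairp j (Finset.mem_sdiff.1 hj).1)
      have hcc := hCcomp u t (hw0.trans hwu) (by linarith)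
      have hce := hCE (t - u) (by linarith)
      have hKu : K u ≤ ε := by
        have := hmin s hws le_rfl
        linarith
      have hGu := hGK u
      have hGu2 : Q * (K u + r * (s - u)) ≤ Q * (ε + r * (s - u)) :=
        mul_le_mul_of_nonneg_left (by linarith) hQpos.le
      have hGeq : G t - G u + ∑ j ∈ M, (D j t - D j u) = C t - C u := hsplit
      have hfin : σ * Q = (t - u) * r * Q - Q * (r * (s - u)) := by
        rw [← hrτ, hτdef]; ring
      linarith
    have hlim : σ * Q ≤ p * Q := by
      refine le_of_forall_pos_le_add (fun ε hε => ?_)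
      have h := step (ε / (Q + R)) (div_pos hε (by linarith))
      have : (Q + R) * (ε / (Q + R)) = ε := by
        have : Q + R ≠ 0 := by linarith
        field_simp
      linarith
    exact le_of_mul_le_mul_right hlim hQpos
  have all : ∀ n : ℕ, ∀ M ⊆ N.erase i, M.card = n → ∀ σ : ℝ, 0 ≤ σ →
      σ * ∑ j ∈ N \ M, φ j ≤ 𝒞 (t - s) - ∑ j ∈ M, E j (t - s) → σ ≤ p := by
    intro n
    induction n with
    | zero =>
      intro M hM hc σ hσ h
      refine main M hM σ hσ h (fun j hj => ?_)
      rw [Finset.card_eq_zero.1 hc] at hj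
      simp at hj
    | succ n ih =>
      intro M hM hc σ hσ h
      by_cases hall : ∀ j ∈ M, E j (t - s) ≤ φ j * σ
      · exact main M hM σ hσ h hall
      · push Not at hall
        obtain ⟨j, hj, hjE⟩ := hall
        have hjN : j ∈ N := Finset.mem_of_mem_erase (hM hj)
        refine ih (M.erase j) ((Finset.erase_subset _ _).trans hM)
          (by rw [Finset.card_erase_of_mem hj, hc]; rfl) σ hσ ?_
        have h1 : N \ M.erase j = insert j (N \ M) := by
          ext k
          simp only [Finset.mem_sdiff, Finset.mem_erase, Finset.mem_insert]
          by_cases hkj : k = j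
          · subst hkj; simp [hjN]
          · simp [hkj]
        have h2 : j ∉ N \ M := by simp [hj]
        rw [h1, Finset.sum_insert h2]
        have h3 := Finset.add_sum_erase M (fun k => E k (t - s)) hj
        linarith
  refine Finset.sup'_le _ _ (fun M hMp => ?_)
  have hM := Finset.mem_powerset.1 hMp
  have hQpos : 0 < ∑ j ∈ N \ M, φ j :=
    Finset.sum_pos (fun k hk => hφ k (Finset.mem_sdiff.1 hk).1)
      ⟨i, Finset.mem_sdiff.2 ⟨hi, fun h => Finset.notMem_erase i N (hM h)⟩⟩
  rw [hDp, div_mul_eq_mul_div, mul_div_assoc]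
  refine mul_le_mul_of_nonneg_left ?_ hφi.le
  rcases le_or_gt 0 ((𝒞 (t - s) - ∑ j ∈ M, E j (t - s)) / ∑ j ∈ N \ M, φ j) with h | h
  · exact all _ M hM rfl _ h (by rw [div_mul_cancel₀ _ hQpos.ne'])
  · exact h.le.trans hp0
end

section
/- Let N be a finite nonempty set of flows with positive weights φ_j > 0, served by a GPS scheduler with arrival processes (A_j)_{j∈N}, departure processes (D_j)_{j∈N}, and service process C. Let M ⊆ N and let (x_j)_{j∈M} be nonnegative numbers that are feasible for the resource X = 1, i.e., for every k ∈ M: (x_k/φ_k)·Σ_{j∈N\M} φ_j ≤ 1 − Σ_{j∈M} x_j. Then for all t ≥ 0: Σ_{j∈M} D_j(t) ≥ Σ_{j∈M} inf_{0 ≤ s ≤ t} { A_j(s) + x_j·(C(t) − C(s)) }. -/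
/-- **Departures theorem.** If `(x_j)_{j∈M}` is a feasible subset of
nonnegative requests for the resource `X = 1`, then the aggregate departures of the
flows in `M` from a GPS scheduler satisfy, for all `t ≥ 0`,
`∑_{j∈M} D_j(t) ≥ ∑_{j∈M} inf_{0 ≤ s ≤ t} {A_j(s) + x_j (C(t) - C(s))}`. -/
theorem gps_departures {ι : Type*} [DecidableEq ι] (N : Finset ι) (hN : N.Nonempty)
    (φ : ι → ℝ) (A D : ι → ℝ → ℝ) (C : ℝ → ℝ)
    (hφ : ∀ j ∈ N, 0 < φ j)
    (hAmono : ∀ j ∈ N, Monotone (A j))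
    (hAlc : ∀ j ∈ N, ∀ t : ℝ, ContinuousWithinAt (A j) (Set.Iio t) t)
    (hAzero : ∀ j ∈ N, ∀ t : ℝ, t ≤ 0 → A j t = 0)
    (hDmono : ∀ j ∈ N, Monotone (D j))
    (hDlc : ∀ j ∈ N, ∀ t : ℝ, ContinuousWithinAt (D j) (Set.Iio t) t)
    (hDzero : ∀ j ∈ N, ∀ t : ℝ, t ≤ 0 → D j t = 0)
    (hCmono : Monotone C)
    (hClc : ∀ t : ℝ, ContinuousWithinAt C (Set.Iio t) t)
    (hCzero : ∀ t : ℝ, t ≤ 0 → C t = 0)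
    (hDA : ∀ j ∈ N, ∀ t : ℝ, D j t ≤ A j t)
    (hwork_le : ∀ s t : ℝ, 0 ≤ s → s ≤ t → ∑ j ∈ N, (D j t - D j s) ≤ C t - C s)
    (hwork_eq : ∀ s t : ℝ, 0 ≤ s → s ≤ t →
      (∀ u : ℝ, s < u → u < t → 0 < ∑ j ∈ N, (A j u - D j u)) →
      ∑ j ∈ N, (D j t - D j s) = C t - C s)
    (hfair : ∀ s t : ℝ, 0 ≤ s → s < t → ∀ i ∈ N,
      (∀ u : ℝ, s < u → u < t → 0 < A i u - D i u) →
      ∀ j ∈ N, (D j t - D j s) / φ j ≤ (D i t - D i s) / φ i)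
    (M : Finset ι) (hM : M ⊆ N)
    (x : ι → ℝ) (hx : ∀ j ∈ M, 0 ≤ x j)
    (hfeas : ∀ k ∈ M, (x k / φ k) * ∑ j ∈ N \ M, φ j ≤ 1 - ∑ j ∈ M, x j) :
    ∀ t : ℝ, 0 ≤ t →
      ∑ j ∈ M, sInf ((fun s => A j s + x j * (C t - C s)) '' Set.Icc 0 t) ≤
        ∑ j ∈ M, D j t := by
  intro t ht
  set F : ι → ℝ → ℝ := fun j t => sInf ((fun s => A j s + x j * (C t - C s)) '' Set.Icc 0 t) with hF
  have hbdd : ∀ j ∈ M, ∀ t : ℝ,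
      BddBelow ((fun s => A j s + x j * (C t - C s)) '' Set.Icc 0 t) := by
    intro j hj t
    refine ⟨0, ?_⟩
    rintro _ ⟨s, hs, rfl⟩
    have h1 : 0 ≤ A j s := by
      rw [← hAzero j (hM hj) 0 le_rfl]; exact hAmono j (hM hj) hs.1
    have h2 : 0 ≤ C t - C s := sub_nonneg.2 (hCmono hs.2)
    have := mul_nonneg (hx j hj) h2
    show 0 ≤ A j s + x j * (C t - C s)
    linarith
  have hFle : ∀ j ∈ M, ∀ s t : ℝ, 0 ≤ s → s ≤ t → F j t ≤ A j s + x j * (C t - C s) := by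
    intro j hj s t h0 hst
    exact csInf_le (hbdd j hj t) ⟨s, ⟨h0, hst⟩, rfl⟩
  have hFstep : ∀ j ∈ M, ∀ r s : ℝ, 0 ≤ r → r ≤ s → F j s ≤ F j r + x j * (C s - C r) := by
    intro j hj r s h0 hrs
    rw [← sub_le_iff_le_add]
    refine le_csInf ((Set.nonempty_Icc.2 h0).image _) ?_
    rintro _ ⟨u, hu, rfl⟩
    have := hFle j hj u s hu.1 (hu.2.trans hrs)
    show F j s - x j * (C s - C r) ≤ A j u + x j * (C r - C u)
    nlinarith
  -- last time the flow was not backlogged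
  have hlast : ∀ k ∈ N, ∀ s : ℝ, 0 ≤ s → ∃ r, 0 ≤ r ∧ r ≤ s ∧ A k r = D k r ∧
      ∀ u, r < u → u ≤ s → 0 < A k u - D k u := by
    intro k hk s hs
    set Z : Set ℝ := {u | u ≤ s ∧ A k u = D k u} with hZ
    have h0 : (0:ℝ) ∈ Z := ⟨hs, by rw [hAzero k hk 0 le_rfl, hDzero k hk 0 le_rfl]⟩
    have hb : BddAbove Z := ⟨s, fun u hu => hu.1⟩
    have hlub := isLUB_csSup ⟨0, h0⟩ hb
    refine ⟨sSup Z, le_csSup hb h0, csSup_le ⟨0, h0⟩ fun u hu => hu.1, ?_, ?_⟩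
    · by_contra hne
      have hpos : D k (sSup Z) < A k (sSup Z) := lt_of_le_of_ne (hDA k hk _) (Ne.symm hne)
      have hev := (hDlc k hk (sSup Z)).eventually_lt (hAlc k hk (sSup Z)) hpos
      rw [eventually_nhdsWithin_iff] at hev
      obtain ⟨ε, hε, hball⟩ := Metric.eventually_nhds_iff.1 hev
      obtain ⟨u, huZ, hu1, hu2⟩ := hlub.exists_between (show sSup Z - ε < sSup Z by linarith)
      have hune : u ≠ sSup Z := by
        rintro h
        exact hne (h ▸ huZ.2)
      have hult := lt_of_le_of_ne hu2 hune
      have := hball (y := u) (by rw [Real.dist_eq, abs_lt]; constructor <;> linarith) hult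
      rw [huZ.2] at this
      exact lt_irrefl _ this
    · intro u hu hus
      rcases lt_or_eq_of_le (hDA k hk u) with h | h
      · linarith
      · exact absurd (le_csSup hb (show u ∈ Z from ⟨hus, h.symm⟩)) (not_le.2 hu)
  have hkey : ∀ k ∈ M, ∀ s : ℝ, 0 ≤ s → D k s < F k s → ∃ r, 0 ≤ r ∧ r < s ∧ A k r = D k r ∧
      ∑ j ∈ M, (D j r - F j r) ≤ ∑ j ∈ M, (D j s - F j s) := by
    intro k hk s hs hbad
    obtain ⟨r, hr0, hrs, hr, hback⟩ := hlast k (hM hk) s hs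
    have hFk := hFle k hk r s hr0 hrs
    have hlt : r < s := by
      rcases lt_or_eq_of_le hrs with h | h
      · exact h
      · subst h
        simp at hFk
        linarith
    refine ⟨r, hr0, hlt, hr, ?_⟩
    have hφk := hφ k (hM hk)
    have hC : 0 ≤ C s - C r := sub_nonneg.2 (hCmono hrs)
    have hD : D k s - D k r ≤ x k * (C s - C r) := by linarith
    have hf := hfair r s hr0 hlt k (hM hk) (fun u h1 h2 => hback u h1 h2.le)
    have hw := hwork_eq r s hr0 hrs (fun u h1 h2 =>
      Finset.sum_pos' (fun j hj => sub_nonneg.2 (hDA j hj u)) ⟨k, hM hk, hback u h1 h2.le⟩)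
    have hout : ∑ j ∈ N \ M, (D j s - D j r) ≤ (1 - ∑ j ∈ M, x j) * (C s - C r) := by
      calc ∑ j ∈ N \ M, (D j s - D j r)
          ≤ ∑ j ∈ N \ M, (x k / φ k * (C s - C r)) * φ j := by
            apply Finset.sum_le_sum
            intro j hj
            have hjN := (Finset.mem_sdiff.1 hj).1
            rw [← div_le_iff₀ (hφ j hjN)]
            refine (hf j hjN).trans ?_
            rw [div_mul_eq_mul_div]
            exact div_le_div_of_nonneg_right hD hφk.le
        _ = (x k / φ k * ∑ j ∈ N \ M, φ j) * (C s - C r) := by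
            rw [← Finset.mul_sum]; ring
        _ ≤ _ := mul_le_mul_of_nonneg_right (hfeas k hk) hC
    have hsplit := Finset.sum_sdiff hM (f := fun j => D j s - D j r)
    have hin : ∑ j ∈ M, x j * (C s - C r) ≤ ∑ j ∈ M, (D j s - D j r) := by
      rw [← Finset.sum_mul]
      linarith
    have hFs := Finset.sum_le_sum (fun j hj => hFstep j hj r s hr0 hrs)
    simp only [Finset.sum_sub_distrib, Finset.sum_add_distrib] at hin hFs ⊢
    linarith
  by_contra hcon
  push Not at hcon
  have hMne : M.Nonempty := by
    by_contra h
    rw [Finset.not_nonempty_iff_eq_empty] at h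
    subst h
    simp at hcon
  have hm : (0:ℝ) < M.card := by exact_mod_cast hMne.card_pos
  obtain ⟨δ, hδ⟩ : ∃ δ : ℝ, δ = (∑ j ∈ M, F j t - ∑ j ∈ M, D j t) / M.card := ⟨_, rfl⟩
  have hδpos : 0 < δ := by rw [hδ]; exact div_pos (sub_pos.2 hcon) hm
  set S : Set ℝ := {s | 0 ≤ s ∧ ∑ j ∈ M, (D j s - F j s) ≤ ∑ j ∈ M, (-δ)} with hS
  have htS : t ∈ S := by
    refine ⟨ht, ?_⟩
    rw [Finset.sum_const, nsmul_eq_mul, Finset.sum_sub_distrib, hδ]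
    have : (M.card : ℝ) ≠ 0 := hm.ne'
    field_simp
    linarith
  have hdesc : ∀ s ∈ S, ∃ k ∈ M, D k s - F k s ≤ -δ ∧ ∃ r ∈ S, r < s ∧ A k r = D k r := by
    intro s hs
    obtain ⟨k, hk, hle⟩ := Finset.exists_le_of_sum_le hMne hs.2
    obtain ⟨r, hr0, hrs, hr, hsum⟩ := hkey k hk s hs.1 (by linarith)
    exact ⟨k, hk, hle, r, ⟨hr0, hsum.trans hs.2⟩, hrs, hr⟩
  have hSb : BddBelow S := ⟨0, fun s hs => hs.1⟩
  have hglb := isGLB_csInf ⟨t, htS⟩ hSb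
  have hgt : ∀ s ∈ S, sInf S < s := by
    intro s hs
    obtain ⟨k, hk, hle, r, hrS, hrs, hr⟩ := hdesc s hs
    exact lt_of_le_of_lt (csInf_le hSb hrS) hrs
  have hev : ∀ᶠ u in nhdsWithin (sInf S) (Set.Ioi (sInf S)), ∀ j ∈ M,
      dist (A j u) (sInf (A j '' Set.Ioi (sInf S))) < δ / 2 := by
    rw [Filter.eventually_all_finset]
    intro j hj
    exact Metric.tendsto_nhds.1 ((hAmono j (hM hj)).tendsto_nhdsGT (sInf S)) (δ / 2) (by linarith)
  rw [eventually_nhdsWithin_iff] at hev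
  obtain ⟨ε, hε, hball⟩ := Metric.eventually_nhds_iff.1 hev
  obtain ⟨s, hsS, hs1, hs2⟩ := hglb.exists_between (show sInf S < sInf S + ε by linarith)
  obtain ⟨k, hk, hle, r, hrS, hrs, hr⟩ := hdesc s hsS
  have hsd := hball (y := s) (by rw [Real.dist_eq, abs_lt]; constructor <;> linarith)
    (hgt s hsS) k hk
  have hrgt := hgt r hrS
  have hrd := hball (y := r) (by rw [Real.dist_eq, abs_lt]; constructor <;> linarith) hrgt k hk
  rw [Real.dist_eq, abs_lt] at hsd hrd
  have h1 := hDmono k (hM hk) hrs.le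
  have h2 := hFle k hk s s hsS.1 le_rfl
  simp only [sub_self, mul_zero, add_zero] at h2
  linarith [hsd.1, hsd.2, hrd.1, hrd.2]
end

section
/- Let N be a finite nonempty set of flows with positive weights φ_j > 0, served by a GPS scheduler with arrival processes (A_j)_{j∈N}, departure processes (D_j)_{j∈N}, backlogs B_j := A_j − D_j, and service process C. Let M ⊆ N and let (x_j)_{j∈M} be nonnegative numbers that are feasible for the resource X = 1, i.e., for every k ∈ M: (x_k/φ_k)·Σ_{j∈N\M} φ_j ≤ 1 − Σ_{j∈M} x_j. Define B_j*(t) := sup_{0 ≤ r ≤ t} { (A_j(t) − A_j(r)) − x_j·(C(t) − C(r)) }. Then for all t ≥ 0: Σ_{j∈M} B_j(t) ≤ Σ_{j∈M} B_j*(t). -/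
/-- Start of the busy period. -/
lemma busy_start (B : ℝ → ℝ) (hB : ∀ t, 0 ≤ B t)
    (hlc : ∀ t : ℝ, ContinuousWithinAt B (Set.Iio t) t) (h0 : B 0 = 0) (t : ℝ) (ht : 0 ≤ t) :
    ∃ s, 0 ≤ s ∧ s ≤ t ∧ B s = 0 ∧ ∀ u, s < u → u < t → 0 < B u := by
  set T : Set ℝ := {r | 0 ≤ r ∧ r ≤ t ∧ B r = 0} with hT
  have h0T : (0 : ℝ) ∈ T := ⟨le_refl _, ht, h0⟩
  have hbdd : BddAbove T := ⟨t, fun r hr => hr.2.1⟩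
  have hlub : IsLUB T (sSup T) := isLUB_csSup ⟨0, h0T⟩ hbdd
  have hmem : sSup T ∈ T := by
    by_contra hn
    have hsub : T ⊆ Set.Iio (sSup T) := fun r hr =>
      lt_of_le_of_ne (hlub.1 hr) (fun h => hn (h ▸ hr))
    have hcl : sSup T ∈ closure T := hlub.mem_closure ⟨0, h0T⟩
    have h1 := ((hlc (sSup T)).mono hsub).mem_closure (t := {0}) hcl (fun r hr => hr.2.2)
    have h2 : B (sSup T) = 0 := by simpa using h1
    exact hn ⟨hlub.1 h0T, hlub.2 (fun r hr => hr.2.1), h2⟩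
  refine ⟨sSup T, hmem.1, hmem.2.1, hmem.2.2, fun u hu hut => ?_⟩
  rcases (hB u).lt_or_eq with h | h
  · exact h
  · exact absurd (hlub.1 (⟨hmem.1.trans hu.le, hut.le, h.symm⟩ : u ∈ T)) (not_le.2 hu)

/-- **Backlog bound.** If `(x_j)_{j∈M}` is a feasible subset of
nonnegative requests for the resource `X = 1`, then the backlogs `B_j = A_j - D_j`
at a GPS scheduler satisfy `∑_{j∈M} B_j(t) ≤ ∑_{j∈M} B*_j(t)`, where
`B*_j(t) = sup_{0 ≤ r ≤ t} {(A_j(t) - A_j(r)) - x_j (C(t) - C(r))}`. -/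
theorem gps_backlog_bound {ι : Type*} [DecidableEq ι] (N : Finset ι) (hN : N.Nonempty)
    (φ : ι → ℝ) (A D : ι → ℝ → ℝ) (C : ℝ → ℝ)
    (hφ : ∀ j ∈ N, 0 < φ j)
    (hAmono : ∀ j ∈ N, Monotone (A j))
    (hAlc : ∀ j ∈ N, ∀ t : ℝ, ContinuousWithinAt (A j) (Set.Iio t) t)
    (hAzero : ∀ j ∈ N, ∀ t : ℝ, t ≤ 0 → A j t = 0)
    (hDmono : ∀ j ∈ N, Monotone (D j))
    (hDlc : ∀ j ∈ N, ∀ t : ℝ, ContinuousWithinAt (D j) (Set.Iio t) t)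
    (hDzero : ∀ j ∈ N, ∀ t : ℝ, t ≤ 0 → D j t = 0)
    (hCmono : Monotone C)
    (hClc : ∀ t : ℝ, ContinuousWithinAt C (Set.Iio t) t)
    (hCzero : ∀ t : ℝ, t ≤ 0 → C t = 0)
    (hDA : ∀ j ∈ N, ∀ t : ℝ, D j t ≤ A j t)
    (hwork_le : ∀ s t : ℝ, 0 ≤ s → s ≤ t → ∑ j ∈ N, (D j t - D j s) ≤ C t - C s)
    (hwork_eq : ∀ s t : ℝ, 0 ≤ s → s ≤ t →
      (∀ u : ℝ, s < u → u < t → 0 < ∑ j ∈ N, (A j u - D j u)) →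
      ∑ j ∈ N, (D j t - D j s) = C t - C s)
    (hfair : ∀ s t : ℝ, 0 ≤ s → s < t → ∀ i ∈ N,
      (∀ u : ℝ, s < u → u < t → 0 < A i u - D i u) →
      ∀ j ∈ N, (D j t - D j s) / φ j ≤ (D i t - D i s) / φ i)
    (M : Finset ι) (hM : M ⊆ N)
    (x : ι → ℝ) (hx : ∀ j ∈ M, 0 ≤ x j)
    (hfeas : ∀ k ∈ M, (x k / φ k) * ∑ j ∈ N \ M, φ j ≤ 1 - ∑ j ∈ M, x j) :
    ∀ t : ℝ, 0 ≤ t →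
      ∑ j ∈ M, (A j t - D j t) ≤
        ∑ j ∈ M,
          sSup ((fun r => (A j t - A j r) - x j * (C t - C r)) '' Set.Icc 0 t) := by
  have hbdd : ∀ j ∈ N, 0 ≤ x j → ∀ t : ℝ, BddAbove
      ((fun r => (A j t - A j r) - x j * (C t - C r)) '' Set.Icc 0 t) := by
    intro j hj hxj t
    refine ⟨A j t, ?_⟩
    rintro _ ⟨r, hr, rfl⟩
    have h1 : 0 ≤ A j r := by
      rw [← hAzero j hj 0 le_rfl]; exact hAmono j hj hr.1
    have h2 : 0 ≤ x j * (C t - C r) := mul_nonneg hxj (sub_nonneg.2 (hCmono hr.2))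
    simp only
    linarith
  have hle : ∀ j ∈ N, 0 ≤ x j → ∀ r t : ℝ, 0 ≤ r → r ≤ t →
      (A j t - A j r) - x j * (C t - C r) ≤
      sSup ((fun r => (A j t - A j r) - x j * (C t - C r)) '' Set.Icc 0 t) :=
    fun j hj hxj r t hr hrt => le_csSup (hbdd j hj hxj t) ⟨r, ⟨hr, hrt⟩, rfl⟩
  have hstep : ∀ j ∈ N, 0 ≤ x j → ∀ s t : ℝ, 0 ≤ s → s ≤ t →
      sSup ((fun r => (A j s - A j r) - x j * (C s - C r)) '' Set.Icc 0 s) ≤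
      sSup ((fun r => (A j t - A j r) - x j * (C t - C r)) '' Set.Icc 0 t)
        - ((A j t - A j s) - x j * (C t - C s)) := by
    intro j hj hxj s t hs hst
    refine csSup_le ⟨_, s, ⟨hs, le_rfl⟩, rfl⟩ ?_
    rintro _ ⟨r, hr, rfl⟩
    have := hle j hj hxj r t hr.1 (hr.2.trans hst)
    simp only
    linarith
  clear hN
  induction M using Finset.strongInduction with
  | H M ih =>
  intro t ht
  rcases M.eq_empty_or_nonempty with rfl | hne
  · simp
  obtain ⟨m, hmM, hmax⟩ := M.exists_max_image (fun j => x j / φ j) hne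
  have hmN := hM hmM
  have hφm := hφ m hmN
  have hxm := hx m hmM
  have hIH := ih (M.erase m) (Finset.erase_ssubset hmM) ((Finset.erase_subset _ _).trans hM)
    (fun j hj => hx j (Finset.mem_of_mem_erase hj)) (by
      intro k hk
      have hkM := Finset.mem_of_mem_erase hk
      have h1 := hfeas k hkM
      have h2 : N \ M.erase m = insert m (N \ M) := by
        ext a
        simp only [Finset.mem_sdiff, Finset.mem_erase, Finset.mem_insert]
        by_cases ha : a = m
        · subst ha; simp [hmN]
        · simp [ha]
      rw [h2, Finset.sum_insert (by simp [hmM])]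
      have h3 := Finset.add_sum_erase M x hmM
      have h4 : x k / φ k * φ m ≤ x m := by
        have := mul_le_mul_of_nonneg_right (hmax k hkM) hφm.le
        rwa [div_mul_cancel₀ _ hφm.ne'] at this
      linarith [mul_add (x k / φ k) (φ m) (∑ j ∈ N \ M, φ j)])
  obtain ⟨s, hs0, hst, hBs, hpos⟩ := busy_start (fun u => A m u - D m u)
    (fun u => sub_nonneg.2 (hDA m hmN u)) (fun u => (hAlc m hmN u).sub (hDlc m hmN u))
    (by simp [hAzero m hmN 0 le_rfl, hDzero m hmN 0 le_rfl]) t ht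
  by_cases hcase : x m * (C t - C s) ≤ D m t - D m s
  · have h1 := hle m hmN hxm s t hs0 hst
    rw [← Finset.add_sum_erase M _ hmM,
      ← Finset.add_sum_erase M (fun j => sSup _) hmM]
    have := hIH t ht
    linarith
  · push Not at hcase
    have hst' : s < t := by
      rcases hst.lt_or_eq with h | h
      · exact h
      · subst h; simp at hcase
    have hC : 0 ≤ C t - C s := sub_nonneg.2 (hCmono hst)
    have hw := hwork_eq s t hs0 hst (fun u hu hut =>
      Finset.sum_pos' (fun j hj => sub_nonneg.2 (hDA j hj u)) ⟨m, hmN, hpos u hu hut⟩)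
    have hfr := hfair s t hs0 hst' m hmN hpos
    have hbase : ∑ j ∈ M, (A j s - D j s) ≤ ∑ j ∈ M,
        sSup ((fun r => (A j s - A j r) - x j * (C s - C r)) '' Set.Icc 0 s) := by
      rw [← Finset.add_sum_erase M _ hmM,
        ← Finset.add_sum_erase M (fun j => sSup _) hmM]
      have h1 := hle m hmN hxm s s hs0 le_rfl
      have := hIH s hs0
      simp only [sub_self, mul_zero] at h1
      linarith
    have hout : ∑ j ∈ N \ M, (D j t - D j s) ≤ (1 - ∑ j ∈ M, x j) * (C t - C s) := by
      have h1 : ∀ j ∈ N \ M, D j t - D j s ≤ (x m / φ m * (C t - C s)) * φ j := by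
        intro j hj
        have hjN := (Finset.mem_sdiff.1 hj).1
        rw [← div_le_iff₀ (hφ j hjN)]
        refine (hfr j hjN).trans ?_
        rw [div_mul_eq_mul_div]
        exact div_le_div_of_nonneg_right hcase.le hφm.le
      refine (Finset.sum_le_sum h1).trans ?_
      rw [← Finset.mul_sum]
      have := mul_le_mul_of_nonneg_right (hfeas m hmM) hC
      linarith
    have hsplit := Finset.sum_sdiff (f := fun j => D j t - D j s) hM
    have hS := Finset.sum_le_sum (fun j hj => hstep j (hM hj) (hx j hj) s t hs0 hst)
    simp only [Finset.sum_sub_distrib, ← Finset.sum_mul] at *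
    linarith
end

section
/- Let A and C be cumulative processes (nondecreasing, with A(t) = C(t) = 0 for t ≤ 0), and let σ ≥ 0, ρ ≥ 0, R > 0, L ≥ 0 and x ≥ 0 be constants with ρ ≤ x·R. Assume A(t) − A(r) ≤ σ + ρ·(t − r) for all 0 ≤ r ≤ t, and C(t) − C(r) ≥ R·max{t − r − L, 0} for all 0 ≤ r ≤ t. Then for every t ≥ 0: sup_{0 ≤ r ≤ t} { (A(t) − A(r)) − x·(C(t) − C(r)) } ≤ σ + ρ·L. -/
/-- If the arrivals `A` comply to the token-bucket envelope
`σ + ρ τ`, the service `C` complies to the latency-rate curve `R [τ - L]₊`, and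
`ρ ≤ x R`, then the virtual backlog
`B*(t) = sup_{0 ≤ r ≤ t} {(A(t) - A(r)) - x (C(t) - C(r))}` is bounded by
`σ + ρ L` for every `t ≥ 0`. -/
theorem virtual_backlog_bound
    (A C : ℝ → ℝ)
    (hAmono : Monotone A) (hAzero : ∀ t : ℝ, t ≤ 0 → A t = 0)
    (hCmono : Monotone C) (hCzero : ∀ t : ℝ, t ≤ 0 → C t = 0)
    (σ ρ R L x : ℝ)
    (hσ : 0 ≤ σ) (hρ : 0 ≤ ρ) (hR : 0 < R) (hL : 0 ≤ L) (hx : 0 ≤ x)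
    (hρxR : ρ ≤ x * R)
    (hAenv : ∀ r t : ℝ, 0 ≤ r → r ≤ t → A t - A r ≤ σ + ρ * (t - r))
    (hCsc : ∀ r t : ℝ, 0 ≤ r → r ≤ t → R * max (t - r - L) 0 ≤ C t - C r) :
    ∀ t : ℝ, 0 ≤ t →
      sSup ((fun r => (A t - A r) - x * (C t - C r)) '' Set.Icc 0 t) ≤ σ + ρ * L := by
  intro t ht
  refine csSup_le ((Set.nonempty_Icc.mpr ht).image _) ?_
  rintro _ ⟨r, ⟨h0, h1⟩, rfl⟩
  have hA := hAenv r t h0 h1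
  have hC := mul_le_mul_of_nonneg_left (hCsc r t h0 h1) hx
  have h2 : ρ * max (t - r - L) 0 ≤ x * R * max (t - r - L) 0 :=
    mul_le_mul_of_nonneg_right hρxR (le_max_right _ _)
  have h3 : ρ * (t - r - L) ≤ ρ * max (t - r - L) 0 :=
    mul_le_mul_of_nonneg_left (le_max_left _ _) hρ
  have h4 : x * R * max (t - r - L) 0 = x * (R * max (t - r - L) 0) := by ring
  have h5 : ρ * (t - r - L) = ρ * (t - r) - ρ * L := by ring
  show (A t - A r) - x * (C t - C r) ≤ σ + ρ * L
  linarith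
end

section
/- Let N be a finite nonempty set of flows with positive weights φ_j > 0, served by a GPS scheduler. Fix i ∈ N. Suppose there exist constants R > 0 and L ≥ 0 with C(t) − C(s) ≥ R·(t − s − L) for all 0 ≤ s ≤ t, and for each j ∈ N \ {i} constants σ_j ≥ 0 and ρ_j ≥ 0 with A_j(t) − A_j(s) ≤ σ_j + ρ_j·(t − s) for all 0 ≤ s < t. Then for all 0 ≤ s < t such that the backlog B_i(u) = A_i(u) − D_i(u) > 0 for every u ∈ (s,t), the departures satisfy D_i(t) − D_i(s) ≥ max over subsets M ⊆ N \ {i} of (φ_i / Σ_{j∈N\M} φ_j)·( R·(t − s − L) − Σ_{j∈M} (σ_j + ρ_j·(t − s)) ). -/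
/-- The arrivals shaped to rate `ρ`. -/
theorem gps_shaped (A : ℝ → ℝ) (hm : Monotone A) (h0 : A 0 = 0) (σ ρ : ℝ) (hρ : 0 ≤ ρ)
    (henv : ∀ s t : ℝ, 0 ≤ s → s < t → A t - A s ≤ σ + ρ * (t - s)) :
    ∃ E : ℝ → ℝ, E 0 ≤ 0 ∧ (∀ u, 0 ≤ u → E u ≤ A u) ∧
      (∀ u w, 0 ≤ u → u ≤ w → E w ≤ E u + ρ * (w - u)) ∧
      (∀ s t, 0 ≤ s → s < t → A t ≤ E s + σ + ρ * (t - s)) := by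
  have hbdd : ∀ w : ℝ, BddBelow ((fun v => A v + ρ * (w - v)) '' Set.Icc 0 w) := by
    intro w
    refine ⟨0, ?_⟩
    rintro _ ⟨v, hv, rfl⟩
    have h1 : 0 ≤ A v := h0 ▸ hm hv.1
    have h2 : 0 ≤ ρ * (w - v) := mul_nonneg hρ (by linarith [hv.2])
    show 0 ≤ A v + ρ * (w - v)
    linarith
  refine ⟨fun w => sInf ((fun v => A v + ρ * (w - v)) '' Set.Icc 0 w), ?_, ?_, ?_, ?_⟩
  · have := csInf_le (hbdd 0) (Set.mem_image_of_mem _ (Set.left_mem_Icc.2 le_rfl))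
    simpa [h0] using this
  · intro u hu
    have := csInf_le (hbdd u) (Set.mem_image_of_mem _ (Set.right_mem_Icc.2 hu))
    simpa using this
  · intro u w hu huw
    have : sInf ((fun v => A v + ρ * (w - v)) '' Set.Icc 0 w) - ρ * (w - u) ≤
        sInf ((fun v => A v + ρ * (u - v)) '' Set.Icc 0 u) := by
      apply le_csInf ((Set.nonempty_Icc.2 hu).image _)
      rintro _ ⟨v, hv, rfl⟩
      have := csInf_le (hbdd w)
        (Set.mem_image_of_mem (fun v => A v + ρ * (w - v)) (⟨hv.1, hv.2.trans huw⟩ : v ∈ Set.Icc 0 w))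
      simp only at this ⊢
      nlinarith
    simp only
    linarith
  · intro s t hs hst
    have : A t - σ - ρ * (t - s) ≤ sInf ((fun v => A v + ρ * (s - v)) '' Set.Icc 0 s) := by
      apply le_csInf ((Set.nonempty_Icc.2 hs).image _)
      rintro _ ⟨v, hv, rfl⟩
      have := henv v t hv.1 (lt_of_le_of_lt hv.2 hst)
      simp only
      nlinarith
    simp only
    linarith

/-- The last time at which a function of bounded growth is nonpositive. -/
theorem gps_last (z : ℝ → ℝ) (ρ : ℝ) (hρ : 0 ≤ ρ) (hz0 : z 0 ≤ 0)
    (hz : ∀ u w, 0 ≤ u → u ≤ w → z w ≤ z u + ρ * (w - u)) (u : ℝ) (hu : 0 ≤ u) :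
    ∃ a, 0 ≤ a ∧ a ≤ u ∧ z a ≤ 0 ∧ ∀ w, a < w → w ≤ u → 0 < z w := by
  set T : Set ℝ := {w | 0 ≤ w ∧ w ≤ u ∧ z w ≤ 0} with hT
  have hne : T.Nonempty := ⟨0, le_rfl, hu, hz0⟩
  have hb : BddAbove T := ⟨u, fun w hw => hw.2.1⟩
  have h0 : 0 ≤ sSup T := le_csSup hb ⟨le_rfl, hu, hz0⟩
  have h1 : sSup T ≤ u := csSup_le hne fun w hw => hw.2.1
  refine ⟨sSup T, h0, h1, ?_, ?_⟩
  · apply le_of_forall_pos_le_add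
    intro ε hε
    obtain ⟨w, hw, hlt⟩ := exists_lt_of_lt_csSup hne
      (show sSup T - ε / (ρ + 1) < sSup T by
        have : 0 < ε / (ρ + 1) := by positivity
        linarith)
    have h2 := hz w (sSup T) hw.1 (le_csSup hb hw)
    have h3 : ρ * (sSup T - w) ≤ ρ * (ε / (ρ + 1)) :=
      mul_le_mul_of_nonneg_left (by linarith) hρ
    have h4 : ρ * (ε / (ρ + 1)) ≤ ε := by
      rw [mul_div_assoc', div_le_iff₀ (by linarith)]
      nlinarith
    linarith [hw.2.2]
  · intro w hw hwu
    by_contra hcon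
    exact absurd (le_csSup hb (⟨h0.trans hw.le, hwu, not_lt.1 hcon⟩ : w ∈ T)) (not_le.2 hw)

/-- Going back in time to a point at which the shaped backlogs are small. -/
theorem gps_back {ι : Type*} (N M : Finset ι) (hMN : M ⊆ N)
    (φ : ι → ℝ) (A D : ι → ℝ → ℝ) (hφ : ∀ j ∈ N, 0 < φ j)
    (hDmono : ∀ j ∈ N, Monotone (D j))
    (hDzero : ∀ j ∈ N, ∀ t : ℝ, t ≤ 0 → D j t = 0)
    (hDA : ∀ j ∈ N, ∀ t : ℝ, D j t ≤ A j t)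
    (hfair : ∀ s t : ℝ, 0 ≤ s → s < t → ∀ i ∈ N,
      (∀ u : ℝ, s < u → u < t → 0 < A i u - D i u) →
      ∀ j ∈ N, (D j t - D j s) / φ j ≤ (D i t - D i s) / φ i)
    (ρ : ι → ℝ) (hρ : ∀ j ∈ M, 0 ≤ ρ j) (r : ℝ) (hr : ∀ j ∈ M, ρ j ≤ φ j * r)
    (E : ι → ℝ → ℝ) (hE0 : ∀ j ∈ M, E j 0 ≤ 0) (hEA : ∀ j ∈ M, ∀ u, 0 ≤ u → E j u ≤ A j u)
    (hEl : ∀ j ∈ M, ∀ u w, 0 ≤ u → u ≤ w → E j w ≤ E j u + ρ j * (w - u))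
    (s : ℝ) (hs : 0 ≤ s) (ε : ℝ) (hε : 0 < ε) :
    ∃ a, 0 ≤ a ∧ a ≤ s ∧ (∀ j ∈ M, E j a - D j a ≤ ε) ∧
      (∀ k ∈ N, D k s - D k a ≤ φ k * r * (s - a)) ∧
      (∀ u, a < u → u < s → 0 < ∑ j ∈ N, (A j u - D j u)) := by
  set S : Set ℝ := {a | 0 ≤ a ∧ a ≤ s ∧ (∀ k ∈ N, D k s - D k a ≤ φ k * r * (s - a)) ∧
      (∀ u, a < u → u < s → 0 < ∑ j ∈ N, (A j u - D j u))} with hS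
  have hsS : s ∈ S := ⟨hs, le_rfl, fun k _ => by simp, fun u h1 h2 => absurd h1 (not_lt.2 h2.le)⟩
  have hb : BddBelow S := ⟨0, fun a ha => ha.1⟩
  by_contra hcon
  have hbig : ∀ a ∈ S, ∃ j ∈ M, ε < E j a - D j a := by
    intro a ha
    by_contra h
    push Not at h
    exact hcon ⟨a, ha.1, ha.2.1, h, ha.2.2.1, ha.2.2.2⟩
  have hP : 0 < ∑ j ∈ M, ρ j + 1 := by
    have := Finset.sum_nonneg hρ
    linarith
  set δ : ℝ := ε / (∑ j ∈ M, ρ j + 1) with hδ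
  have hδ0 : 0 < δ := by positivity
  obtain ⟨u, huS, hult⟩ := exists_lt_of_csInf_lt ⟨s, hsS⟩ (show sInf S < sInf S + δ by linarith)
  obtain ⟨j, hj, hjε⟩ := hbig u huS
  have hjN := hMN hj
  have hzl : ∀ v w, 0 ≤ v → v ≤ w →
      E j w - D j w ≤ E j v - D j v + ρ j * (w - v) := by
    intro v w hv hvw
    have := hEl j hj v w hv hvw
    have := hDmono j hjN hvw
    linarith
  obtain ⟨a, ha0, hau, haz, hap⟩ := gps_last (fun w => E j w - D j w) (ρ j) (hρ j hj)
    (by have := hE0 j hj; have := hDzero j hjN 0 le_rfl; linarith) hzl u huS.1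
  have hback : ∀ w, a < w → w ≤ u → 0 < A j w - D j w := by
    intro w h1 h2
    have := hap w h1 h2
    have := hEA j hj w (ha0.trans h1.le)
    linarith
  have hstep := hzl a u ha0 hau
  have hd : δ ≤ u - a := by
    have h1 : ρ j ≤ ∑ j ∈ M, ρ j := Finset.single_le_sum hρ hj
    rw [hδ, div_le_iff₀ hP]
    nlinarith
  have hau' : a < u := by linarith
  have haS : a ∈ S := by
    refine ⟨ha0, hau.trans huS.2.1, ?_, ?_⟩
    · intro k hk
      have h1 := hfair a u ha0 hau' j hjN (fun w h1 h2 => hback w h1 h2.le) k hk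
      have h2 := hEl j hj a u ha0 hau
      have h3 : D j u - D j a ≤ φ j * r * (u - a) := by
        have : ρ j * (u - a) ≤ φ j * r * (u - a) :=
          mul_le_mul_of_nonneg_right (hr j hj) (by linarith)
        linarith
      have h4 : (D j u - D j a) / φ j ≤ r * (u - a) := by
        rw [div_le_iff₀ (hφ j hjN)]
        linarith
      have h5 := h1.trans h4
      rw [div_le_iff₀ (hφ k hk)] at h5
      have h6 := huS.2.2.1 k hk
      linarith
    · intro w h1 h2
      rcases le_or_gt w u with h | h
      · exact Finset.sum_pos' (fun k hk => by linarith [hDA k hk w]) ⟨j, hjN, hback w h1 h⟩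
      · exact huS.2.2.2 w h h2
  have := csInf_le hb haS
  linarith

/-- **token-bucket / latency-rate leftover service.** If the service
of a GPS scheduler complies to the latency-rate curve `R (τ - L)` and the arrivals
of every flow `j ≠ i` comply to the token-bucket envelope `σ_j + ρ_j τ`, then on any
interval `(s,t)` throughout which flow `i` is backlogged,
`D_i(s,t) ≥ max_{M ⊆ N\{i}} (φ_i / ∑_{j∉M} φ_j) (R (t-s-L) - ∑_{j∈M} (σ_j + ρ_j (t-s)))`. -/
theorem gps_leftover_latency_rate {ι : Type*} [DecidableEq ι] (N : Finset ι) (hN : N.Nonempty)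
    (φ : ι → ℝ) (A D : ι → ℝ → ℝ) (C : ℝ → ℝ)
    (hφ : ∀ j ∈ N, 0 < φ j)
    (hAmono : ∀ j ∈ N, Monotone (A j))
    (hAlc : ∀ j ∈ N, ∀ t : ℝ, ContinuousWithinAt (A j) (Set.Iio t) t)
    (hAzero : ∀ j ∈ N, ∀ t : ℝ, t ≤ 0 → A j t = 0)
    (hDmono : ∀ j ∈ N, Monotone (D j))
    (hDlc : ∀ j ∈ N, ∀ t : ℝ, ContinuousWithinAt (D j) (Set.Iio t) t)
    (hDzero : ∀ j ∈ N, ∀ t : ℝ, t ≤ 0 → D j t = 0)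
    (hCmono : Monotone C)
    (hClc : ∀ t : ℝ, ContinuousWithinAt C (Set.Iio t) t)
    (hCzero : ∀ t : ℝ, t ≤ 0 → C t = 0)
    (hDA : ∀ j ∈ N, ∀ t : ℝ, D j t ≤ A j t)
    (hwork_le : ∀ s t : ℝ, 0 ≤ s → s ≤ t → ∑ j ∈ N, (D j t - D j s) ≤ C t - C s)
    (hwork_eq : ∀ s t : ℝ, 0 ≤ s → s ≤ t →
      (∀ u : ℝ, s < u → u < t → 0 < ∑ j ∈ N, (A j u - D j u)) →
      ∑ j ∈ N, (D j t - D j s) = C t - C s)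
    (hfair : ∀ s t : ℝ, 0 ≤ s → s < t → ∀ i ∈ N,
      (∀ u : ℝ, s < u → u < t → 0 < A i u - D i u) →
      ∀ j ∈ N, (D j t - D j s) / φ j ≤ (D i t - D i s) / φ i)
    (i : ι) (hi : i ∈ N)
    (R L : ℝ) (hR : 0 < R) (hL : 0 ≤ L)
    (hCcomp : ∀ s t : ℝ, 0 ≤ s → s ≤ t → R * (t - s - L) ≤ C t - C s)
    (σ ρ : ι → ℝ)
    (hσ : ∀ j ∈ N.erase i, 0 ≤ σ j) (hρ : ∀ j ∈ N.erase i, 0 ≤ ρ j)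
    (hAenv : ∀ j ∈ N.erase i, ∀ s t : ℝ, 0 ≤ s → s < t →
      A j t - A j s ≤ σ j + ρ j * (t - s)) :
    ∀ s t : ℝ, 0 ≤ s → s < t →
      (∀ u : ℝ, s < u → u < t → 0 < A i u - D i u) →
      (N.erase i).powerset.sup' ⟨∅, Finset.empty_mem_powerset _⟩
          (fun M => (φ i / ∑ j ∈ N \ M, φ j) *
            (R * (t - s - L) - ∑ j ∈ M, (σ j + ρ j * (t - s)))) ≤
        D i t - D i s := by
  intro s t hs hst hback
  obtain ⟨M, hM, hMeq⟩ := Finset.exists_mem_eq_sup' (s := (N.erase i).powerset)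
    ⟨∅, Finset.empty_mem_powerset _⟩
    (fun M => (φ i / ∑ j ∈ N \ M, φ j) *
            (R * (t - s - L) - ∑ j ∈ M, (σ j + ρ j * (t - s))))
  have hmax : ∀ M' ∈ (N.erase i).powerset, (φ i / ∑ j ∈ N \ M', φ j) *
            (R * (t - s - L) - ∑ j ∈ M', (σ j + ρ j * (t - s))) ≤
            (φ i / ∑ j ∈ N \ M, φ j) *
            (R * (t - s - L) - ∑ j ∈ M, (σ j + ρ j * (t - s))) := by
    intro M' hM'
    rw [← hMeq]
    exact Finset.le_sup' (fun M => (φ i / ∑ j ∈ N \ M, φ j) *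
            (R * (t - s - L) - ∑ j ∈ M, (σ j + ρ j * (t - s)))) hM'
  rw [hMeq]
  by_contra hcon
  push Not at hcon
  have hMe : M ⊆ N.erase i := Finset.mem_powerset.1 hM
  have hMN : M ⊆ N := hMe.trans (Finset.erase_subset _ _)
  have hφi := hφ i hi
  have hΦ : ∀ M' ⊆ N.erase i, 0 < ∑ j ∈ N \ M', φ j := by
    intro M' hM'
    apply Finset.sum_pos (fun j hj => hφ j (Finset.mem_sdiff.1 hj).1)
    exact ⟨i, Finset.mem_sdiff.2 ⟨hi, fun h => Finset.notMem_erase i N (hM' h)⟩⟩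
  have hτ : 0 < t - s := by linarith
  set Φ := ∑ j ∈ N \ M, φ j with hΦdef
  have hΦpos : 0 < Φ := hΦ M hMe
  set x := R * (t - s - L) with hx
  set e := ∑ j ∈ M, (σ j + ρ j * (t - s)) with he
  -- normalized optimal value
  set θ' := (x - e) / Φ with hθ'
  have hθΦ : Φ * θ' = x - e := by rw [hθ']; field_simp
  have hg : ∀ y, φ i / Φ * y = φ i * (y / Φ) := by intro y; ring
  have hθlt : (D i t - D i s) / φ i < θ' := by
    rw [div_lt_iff₀ hφi]
    rw [hg] at hcon
    linarith
  set r := θ' / (t - s) with hr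
  have hrτ : r * (t - s) = θ' := by rw [hr]; field_simp
  have hrj : ∀ j ∈ M, ρ j ≤ φ j * r := by
    intro j hj
    have hφj := hφ j (hMN hj)
    have h1 := hmax (M.erase j) (Finset.mem_powerset.2 ((Finset.erase_subset _ _).trans hMe))
    have h2 : ∑ k ∈ N \ M.erase j, φ k = Φ + φ j := by
      rw [Finset.sdiff_erase (hMN hj), Finset.sum_insert (by simp [hj])]
      ring
    have h3 : ∑ k ∈ M.erase j, (σ k + ρ k * (t - s)) = e - (σ j + ρ j * (t - s)) := by
      rw [Finset.sum_erase_eq_sub hj]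
    rw [h2, h3, hg, div_mul_eq_mul_div, mul_div_assoc] at h1
    have h4 : (x - (e - (σ j + ρ j * (t - s)))) / (Φ + φ j) ≤ θ' :=
      le_of_mul_le_mul_left h1 hφi
    rw [div_le_iff₀ (by linarith)] at h4
    have h5 := hσ j (hMe hj)
    have h6 : ρ j * (t - s) ≤ φ j * r * (t - s) := by
      rw [mul_assoc, hrτ]
      nlinarith
    exact le_of_mul_le_mul_right h6 hτ
  have hcap : Φ * r + ∑ j ∈ M, ρ j ≤ R := by
    have h1 : (∑ j ∈ M, ρ j) * (t - s) ≤ e := by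
      rw [Finset.sum_mul, he]
      exact Finset.sum_le_sum fun j hj => by linarith [hσ j (hMe hj)]
    have h2 : x ≤ R * (t - s) := by
      rw [hx]
      exact mul_le_mul_of_nonneg_left (by linarith) hR.le
    have h3 : (Φ * r + ∑ j ∈ M, ρ j) * (t - s) ≤ R * (t - s) := by
      rw [add_mul, mul_assoc, hrτ]
      linarith
    exact le_of_mul_le_mul_right h3 hτ
  -- shaped arrivals
  have hsh : ∀ j, ∃ E : ℝ → ℝ, j ∈ M → (E 0 ≤ 0 ∧ (∀ u, 0 ≤ u → E u ≤ A j u) ∧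
      (∀ u w, 0 ≤ u → u ≤ w → E w ≤ E u + ρ j * (w - u)) ∧
      (∀ s t, 0 ≤ s → s < t → A j t ≤ E s + σ j + ρ j * (t - s))) := by
    intro j
    by_cases hj : j ∈ M
    · obtain ⟨E, hE⟩ := gps_shaped (A j) (hAmono j (hMN hj)) (hAzero j (hMN hj) 0 le_rfl)
        (σ j) (ρ j) (hρ j (hMe hj)) (hAenv j (hMe hj))
      exact ⟨E, fun _ => hE⟩
    · exact ⟨fun _ => 0, fun h => absurd h hj⟩
  choose E hE using hsh
  have hkey : ∀ ε : ℝ, 0 < ε → x ≤ Φ * ((D i t - D i s) / φ i) + e + M.card * ε := by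
    intro ε hε
    obtain ⟨a, ha0, has, haz, haD, hbusy⟩ := gps_back N M hMN φ A D hφ hDmono hDzero hDA hfair ρ
      (fun j hj => hρ j (hMe hj)) r hrj E (fun j hj => (hE j hj).1) (fun j hj => (hE j hj).2.1)
      (fun j hj => (hE j hj).2.2.1) s hs ε hε
    have hC1 := hwork_eq a s ha0 has hbusy
    have hC2 := hwork_eq s t hs hst.le (fun u h1 h2 =>
      Finset.sum_pos' (fun k hk => by linarith [hDA k hk u]) ⟨i, hi, hback u h1 h2⟩)
    have hC3 := hCcomp a t ha0 (has.trans hst.le)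
    rw [← Finset.sum_sdiff hMN] at hC1 hC2
    have h1 : ∑ j ∈ N \ M, (D j s - D j a) ≤ Φ * r * (s - a) := by
      rw [hΦdef, Finset.sum_mul, Finset.sum_mul]
      exact Finset.sum_le_sum fun k hk => haD k (Finset.mem_sdiff.1 hk).1
    have h2 : ∑ j ∈ N \ M, (D j t - D j s) ≤ Φ * ((D i t - D i s) / φ i) := by
      rw [hΦdef, Finset.sum_mul]
      refine Finset.sum_le_sum fun k hk => ?_
      have hkN := (Finset.mem_sdiff.1 hk).1
      have := hfair s t hs hst i hi hback k hkN
      rw [div_le_iff₀ (hφ k hkN)] at this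
      linarith
    have h3 : ∑ j ∈ M, (D j t - D j s) + ∑ j ∈ M, (D j s - D j a) ≤
        e + M.card * ε + (∑ j ∈ M, ρ j) * (s - a) := by
      have : (M.card : ℝ) * ε = ∑ j ∈ M, ε := by simp
      rw [this, he, Finset.sum_mul, ← Finset.sum_add_distrib, ← Finset.sum_add_distrib,
        ← Finset.sum_add_distrib]
      refine Finset.sum_le_sum fun j hj => ?_
      obtain ⟨_, _, hl, hu⟩ := hE j hj
      have h4 := hl a s ha0 has
      have h5 := hu s t hs hst
      have h6 := haz j hj
      have h7 := hDA j (hMN hj) t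
      linarith
    have h4 : (Φ * r + ∑ j ∈ M, ρ j) * (s - a) ≤ R * (s - a) :=
      mul_le_mul_of_nonneg_right hcap (by linarith)
    have h5 : R * (t - a - L) = x + R * (s - a) := by rw [hx]; ring
    linarith
  have hgap : 0 < Φ * (θ' - (D i t - D i s) / φ i) := mul_pos hΦpos (by linarith)
  have hc : (0 : ℝ) < M.card + 1 := by positivity
  have h1 := hkey (Φ * (θ' - (D i t - D i s) / φ i) / (M.card + 1)) (by positivity)
  have h2 : (M.card : ℝ) * (Φ * (θ' - (D i t - D i s) / φ i) / (M.card + 1)) <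
      Φ * (θ' - (D i t - D i s) / φ i) := by
    rw [mul_div_assoc', div_lt_iff₀ hc]
    nlinarith
  linarith
end
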